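/- Let A = A₀ + α₁ b₁c₁ᵀ + ⋯ + α_m b_m c_mᵀ be an n×n 1CM-matrix, regarded over the larger field K' = ℝ(α₁,…,α_{2m}). Let Ã̃ be its layered sparse representation: the (n+2m)×(n+2m) matrix over K' with row blocks of sizes (m, n, m) and column blocks of sizes (m, m, n) given by Ã̃ = [[I_m, O, Cᵀ], [O, B, A₀], [diag(α₁,…,α_m), diag(α_{m+1},…,α_{2m}), O]], where Cᵀ is the m×n matrix with rows c₁ᵀ,…,c_mᵀ and B is the n×m matrix with columns b₁,…,b_m. Then rank A = rank Ã̃ − 2m, both ranks taken over K'. -/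

import Mathlib

open Matrix MvPolynomial

noncomputable section

/-- The field `K' = ℝ(α₁,…,α_{2m})` of rational functions over `ℝ` in `2m` indeterminates. -/
abbrev Kf' (m : ℕ) : Type := FractionRing (MvPolynomial (Fin (2 * m)) ℝ)

/-- Canonical embedding of `ℝ` into `Kf' m`. -/
def φ' (m : ℕ) : ℝ →+* Kf' m :=
  (algebraMap (MvPolynomial (Fin (2 * m)) ℝ) (Kf' m)).comp (MvPolynomial.C)

/-- The indeterminate `α_k` as an element of `Kf' m`. -/
def α' (m : ℕ) (k : Fin (2 * m)) : Kf' m :=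
  algebraMap (MvPolynomial (Fin (2 * m)) ℝ) (Kf' m) (MvPolynomial.X k)

/-- The 1CM-matrix `A = A₀ + α₁ b₁c₁ᵀ + ⋯ + α_m b_m c_mᵀ`, regarded over `K' = ℝ(α₁,…,α_{2m})`
(only the first `m` indeterminates occur in `A`). -/
def oneCM' (n m : ℕ) (A₀ : Matrix (Fin n) (Fin n) ℝ) (b c : Fin m → Fin n → ℝ) :
    Matrix (Fin n) (Fin n) (Kf' m) :=
  A₀.map (φ' m) +
    ∑ k : Fin m, α' m ⟨k.1, by omega⟩ • (Matrix.vecMulVec (b k) (c k)).map (φ' m)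

/-- The layered sparse representation
`Ã̃ = [[I_m, O, Cᵀ], [O, B, A₀], [diag(α₁,…,α_m), diag(α_{m+1},…,α_{2m}), O]]`,
with row blocks of sizes `(m, n, m)` and column blocks of sizes `(m, m, n)`. -/
def layeredSparseRep (n m : ℕ) (A₀ : Matrix (Fin n) (Fin n) ℝ)
    (b c : Fin m → Fin n → ℝ) :
    Matrix (Fin m ⊕ (Fin n ⊕ Fin m)) ((Fin m ⊕ Fin m) ⊕ Fin n) (Kf' m) :=
  Matrix.of fun r cc =>
    match r, cc with
    | Sum.inl i, Sum.inl (Sum.inl j) => if i = j then 1 else 0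
    | Sum.inl _, Sum.inl (Sum.inr _) => 0
    | Sum.inl i, Sum.inr j => φ' m (c i j)
    | Sum.inr (Sum.inl _), Sum.inl (Sum.inl _) => 0
    | Sum.inr (Sum.inl i), Sum.inl (Sum.inr k) => φ' m (b k i)
    | Sum.inr (Sum.inl i), Sum.inr j => φ' m (A₀ i j)
    | Sum.inr (Sum.inr k), Sum.inl (Sum.inl j) =>
        if k = j then α' m ⟨k.1, by omega⟩ else 0
    | Sum.inr (Sum.inr k), Sum.inl (Sum.inr j) =>
        if k = j then α' m ⟨m + k.1, by omega⟩ else 0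
    | Sum.inr (Sum.inr _), Sum.inr _ => 0

namespace Matrix

variable {F G ι κ : Type*} [Field F] [Field G] [Fintype ι] [DecidableEq ι] [Fintype κ]
  [DecidableEq κ]

/-- Every square matrix over a field is equivalent to a diagonal matrix. -/
lemma exists_isUnit_mul_mul_eq_diagonal (M : Matrix ι ι F) :
    ∃ (V U : Matrix ι ι F) (w : ι → F), IsUnit V ∧ IsUnit U ∧ V * M * U = diagonal w := by
  obtain ⟨V, U, e, hV, hU, h⟩ := exists_rank_normal_form M
  refine ⟨V, U, Sum.elim (fun _ ↦ 1) (fun _ ↦ 0) ∘ e, hV, hU, ?_⟩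
  rw [h, ← diagonal_one, ← diagonal_zero, fromBlocks_diagonal, submatrix_diagonal_equiv]

lemma rank_mul_mul_of_isUnit {V U : Matrix ι ι F} (hV : IsUnit V) (hU : IsUnit U)
    (M : Matrix ι ι F) : (V * M * U).rank = M.rank := by
  rw [rank_mul_eq_left_of_isUnit_det U _ ((isUnit_iff_isUnit_det _).1 hU),
    rank_mul_eq_right_of_isUnit_det V _ ((isUnit_iff_isUnit_det _).1 hV)]

/-- The rank of a square matrix is invariant under field extension. -/
lemma rank_map_ringHom (f : F →+* G) (M : Matrix ι ι F) : (M.map f).rank = M.rank := by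
  classical
  obtain ⟨V, U, w, hV, hU, h⟩ := exists_isUnit_mul_mul_eq_diagonal M
  have h' : V.map f * M.map f * U.map f = diagonal (f ∘ w) := by
    rw [← Matrix.map_mul, ← Matrix.map_mul, h, diagonal_map (map_zero f)]
    rfl
  rw [← rank_mul_mul_of_isUnit hV hU, h,
    ← rank_mul_mul_of_isUnit (hV.map f.mapMatrix) (hU.map f.mapMatrix)]
  simp only [RingHom.mapMatrix_apply, h', rank_diagonal, Function.comp_apply, ne_eq, map_eq_zero]

lemma rank_fromBlocks_one_zero_zero (S : Matrix κ κ F) :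
    (fromBlocks (1 : Matrix ι ι F) 0 0 S).rank = Fintype.card ι + S.rank := by
  classical
  obtain ⟨V, U, w, hV, hU, h⟩ := exists_isUnit_mul_mul_eq_diagonal S
  have hV' : IsUnit (fromBlocks (1 : Matrix ι ι F) 0 0 V) :=
    isUnit_fromBlocks_zero₁₂.2 ⟨isUnit_one, hV⟩
  have hU' : IsUnit (fromBlocks (1 : Matrix ι ι F) 0 0 U) :=
    isUnit_fromBlocks_zero₁₂.2 ⟨isUnit_one, hU⟩
  rw [← rank_mul_mul_of_isUnit hV' hU', ← rank_mul_mul_of_isUnit hV hU, h]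
  simp only [fromBlocks_multiply, Matrix.mul_zero, Matrix.zero_mul, add_zero, zero_add,
    Matrix.mul_one, h]
  have hd : fromBlocks (1 : Matrix ι ι F) 0 0 (diagonal w) = diagonal (Sum.elim 1 w) := by
    rw [← fromBlocks_diagonal]
    exact congrArg (fromBlocks · 0 0 (diagonal w)) diagonal_one.symm
  rw [hd, rank_diagonal, rank_diagonal, Fintype.card_congr Equiv.subtypeSum, Fintype.card_sum]
  simp only [Sum.elim_inl, Sum.elim_inr, Pi.one_apply, ne_eq, one_ne_zero, not_false_eq_true,
    Fintype.card_subtype_true]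
  congr!

/-- Guttman rank additivity for the Schur complement of an invertible upper left block. -/
lemma rank_fromBlocks_of_isUnit₁₁ {P : Matrix ι ι F} (hP : IsUnit P) (Q : Matrix ι κ F)
    (R : Matrix κ ι F) (S : Matrix κ κ F) :
    (fromBlocks P Q R S).rank = Fintype.card ι + (S - R * P⁻¹ * Q).rank := by
  have := hP.invertible
  have hL : IsUnit (fromBlocks P 0 R (1 : Matrix κ κ F)) :=
    isUnit_fromBlocks_zero₁₂.2 ⟨hP, isUnit_one⟩
  have hR : IsUnit (fromBlocks (1 : Matrix ι ι F) (P⁻¹ * Q) 0 (1 : Matrix κ κ F)) :=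
    isUnit_fromBlocks_zero₂₁.2 ⟨isUnit_one, isUnit_one⟩
  rw [← rank_fromBlocks_one_zero_zero,
    ← rank_mul_mul_of_isUnit hL hR (fromBlocks 1 0 0 _)]
  simp [fromBlocks_multiply, Matrix.mul_assoc]

end Matrix

/-- The substitution `α_k ↦ α_k α_{m+k}`, `α_{m+k} ↦ α_{m+k}` for `k < m`. -/
def twist (m : ℕ) : MvPolynomial (Fin (2 * m)) ℝ →ₐ[ℝ] MvPolynomial (Fin (2 * m)) ℝ :=
  aeval fun k ↦ if h : k.1 < m then X k * X ⟨m + k.1, by omega⟩ else X k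

lemma twist_injective (m : ℕ) : Function.Injective (twist m) := by
  refine (injective_iff_map_eq_zero _).2 fun p hp ↦ ?_
  refine funext_set (fun _ ↦ {0}ᶜ) (fun _ ↦ (Set.finite_singleton 0).infinite_compl) fun y hy ↦ ?_
  have hy (k) : y k ≠ 0 := hy k trivial
  let x : Fin (2 * m) → ℝ := fun k ↦ if h : k.1 < m then y k / y ⟨m + k.1, by omega⟩ else y k
  have key : (MvPolynomial.aeval x).comp (twist m) = MvPolynomial.aeval y := by
    ext k
    by_cases h : k.1 < m
    · simp [twist, x, h, hy]
    · simp [twist, x, h]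
  have := DFunLike.congr_fun key p
  rw [AlgHom.comp_apply, hp, map_zero] at this
  rw [map_zero, ← coe_aeval_eq_eval]
  exact this.symm

/-- The extension of `twist` to the field of rational functions. -/
def twistField (m : ℕ) : Kf' m →+* Kf' m :=
  IsFractionRing.map (A := MvPolynomial (Fin (2 * m)) ℝ) (K := Kf' m) (L := Kf' m)
    (j := (twist m).toRingHom) (twist_injective m)

lemma twistField_algebraMap (m : ℕ) (p : MvPolynomial (Fin (2 * m)) ℝ) :
    twistField m (algebraMap _ (Kf' m) p) = algebraMap _ (Kf' m) (twist m p) :=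
  IsLocalization.map_eq (S := Kf' m) (Q := Kf' m) (g := (twist m).toRingHom)
    (nonZeroDivisors_le_comap_nonZeroDivisors_of_injective _ (twist_injective m)) p

lemma twistField_φ' (m : ℕ) (r : ℝ) : twistField m (φ' m r) = φ' m r := by
  simp only [φ', RingHom.comp_apply, twistField_algebraMap]
  congr 1
  exact (twist m).commutes r

lemma α'_ne_zero (m : ℕ) (k : Fin (2 * m)) : α' m k ≠ 0 := by
  simp [α']

lemma twistField_α'_div (m : ℕ) (k : Fin m) :
    twistField m (α' m ⟨k.1, by omega⟩ / α' m ⟨m + k.1, by omega⟩) = α' m ⟨k.1, by omega⟩ := by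
  have h₁ : twistField m (α' m ⟨k.1, by omega⟩) =
      α' m ⟨k.1, by omega⟩ * α' m ⟨m + k.1, by omega⟩ := by
    simp [α', twistField_algebraMap, twist]
  have h₂ : twistField m (α' m ⟨m + k.1, by omega⟩) = α' m ⟨m + k.1, by omega⟩ := by
    simp [α', twistField_algebraMap, twist]
  rw [map_div₀, h₁, h₂, mul_div_cancel_right₀ _ (α'_ne_zero m _)]

/-- `rank A = rank Ã̃ − 2m`, i.e. `rank Ã̃ = rank A + 2m`, both ranks over `K'`. -/
theorem stmt_2 (n m : ℕ) (A₀ : Matrix (Fin n) (Fin n) ℝ) (b c : Fin m → Fin n → ℝ) :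
    (layeredSparseRep n m A₀ b c).rank = (oneCM' n m A₀ b c).rank + 2 * m := by
  let D₁ : Fin m → Kf' m := fun k ↦ α' m ⟨k.1, by omega⟩
  let D₂ : Fin m → Kf' m := fun k ↦ α' m ⟨m + k.1, by omega⟩
  let P : Matrix (Fin m ⊕ Fin m) (Fin m ⊕ Fin m) (Kf' m) :=
    fromBlocks 1 0 (diagonal D₁) (diagonal D₂)
  let Q : Matrix (Fin m ⊕ Fin m) (Fin n) (Kf' m) := fromRows (of fun i j ↦ φ' m (c i j)) 0
  let R : Matrix (Fin n) (Fin m ⊕ Fin m) (Kf' m) := fromCols 0 (of fun i k ↦ φ' m (b k i))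
  have hD₂ : IsUnit (diagonal D₂) :=
    isUnit_diagonal.2 (Pi.isUnit_iff.2 fun k ↦ (α'_ne_zero m _).isUnit)
  have hP : IsUnit P := isUnit_fromBlocks_zero₁₂.2 ⟨isUnit_one, hD₂⟩
  let P' : Matrix (Fin m ⊕ Fin m) (Fin m ⊕ Fin m) (Kf' m) :=
    fromBlocks 1 0 (-diagonal fun k ↦ D₁ k / D₂ k) (diagonal fun k ↦ (D₂ k)⁻¹)
  have hPinv : P⁻¹ = P' := by
    refine inv_eq_left_inv ?_
    have h (k) : D₂ k ≠ 0 := α'_ne_zero m _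
    simp [P, P', fromBlocks_multiply, div_eq_inv_mul, h]
  let e : Fin m ⊕ (Fin n ⊕ Fin m) ≃ (Fin m ⊕ Fin m) ⊕ Fin n :=
    ((Equiv.refl _).sumCongr (Equiv.sumComm _ _)).trans (Equiv.sumAssoc _ _ _).symm
  have hL : reindex e (Equiv.refl _) (layeredSparseRep n m A₀ b c) =
      fromBlocks P Q R (A₀.map (φ' m)) := by
    ext i j
    rcases i with (i | i) | i <;> rcases j with (j | j) | j <;>
      simp [e, layeredSparseRep, P, Q, R, D₁, D₂, one_apply, diagonal_apply]
  have hA : (A₀.map (φ' m) - R * P⁻¹ * Q).map (twistField m) = oneCM' n m A₀ b c := by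
    rw [hPinv]
    ext i j
    simp [P', Q, R, oneCM', fromCols_mul_fromBlocks, fromCols_mul_fromRows, D₁, D₂,
      twistField_φ', Matrix.sum_apply, vecMulVec_apply, Matrix.mul_apply,
      diagonal_apply, -map_div₀, twistField_α'_div]
    exact Finset.sum_congr rfl fun k _ ↦ by ring
  rw [← rank_reindex e (Equiv.refl _), hL, rank_fromBlocks_of_isUnit₁₁ hP, ← hA,
    rank_map_ringHom, Fintype.card_sum, Fintype.card_fin]
  ring

end
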